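/- Let V and W be finite-dimensional real normed vector spaces, let θ : V → ℝ be a nonzero linear functional and τ an alternating bilinear form on V whose restriction to ker θ is nondegenerate, and let Z be a linear subspace of W with quotient map π : W → W/Z. Then the set 𝓛 of all (continuous) linear maps L : V → W such that (i) π ∘ L : V → W/Z is surjective, (ii) the subspace K_L := ker(π ∘ L) is not contained in ker θ, and (iii) the restriction of τ to K_L ∩ ker θ is nondegenerate (if v ∈ K_L ∩ ker θ and τ(v, w) = 0 for all w ∈ K_L ∩ ker θ, then v = 0), is an open subset of the space of linear maps from V to W equipped with the operator-norm topology. -/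

import Mathlib

/-- The augmented linear system `(v, l) ↦ (τ v + l ∘ A, A v)` attached to a bilinear form `τ` on `V`
and a constraint map `A : V → U`. -/
noncomputable def augmentedSystem {V U : Type*} [NormedAddCommGroup V] [NormedSpace ℝ V]
    [NormedAddCommGroup U] [NormedSpace ℝ U] (τ : V →L[ℝ] V →L[ℝ] ℝ) (A : V →L[ℝ] U) :
    V × (U →L[ℝ] ℝ) →L[ℝ] (V →L[ℝ] ℝ) × U :=
  (τ ∘L .fst ℝ V (U →L[ℝ] ℝ) +
    (ContinuousLinearMap.compL ℝ V U ℝ).flip A ∘L .snd ℝ V (U →L[ℝ] ℝ)).prod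
    (A ∘L .fst ℝ V (U →L[ℝ] ℝ))

/-- A constraint map `A` is surjective with `τ` nondegenerate on `ker A` exactly when the augmented
system is injective. -/
theorem augmentedSystem_injective_iff {V U : Type*} [NormedAddCommGroup V] [NormedSpace ℝ V]
    [NormedAddCommGroup U] [NormedSpace ℝ U] [FiniteDimensional ℝ U]
    (τ : V →L[ℝ] V →L[ℝ] ℝ) (A : V →L[ℝ] U) :
    Function.Injective (augmentedSystem τ A) ↔ Function.Surjective A ∧
      ∀ v, A v = 0 → (∀ w, A w = 0 → τ v w = 0) → v = 0 := by
  rw [injective_iff_map_eq_zero]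
  constructor
  · intro h
    refine ⟨?_, fun v hv hτ => ?_⟩
    · rw [← ContinuousLinearMap.coe_coe, ← LinearMap.dualMap_injective_iff,
        injective_iff_map_eq_zero]
      intro l hl
      have key := h (0, LinearMap.toContinuousLinearMap l) (by
        ext w
        · simpa [augmentedSystem] using LinearMap.congr_fun hl w
        · simp [augmentedSystem])
      ext u
      exact congrArg (fun p : V × (U →L[ℝ] ℝ) => p.2 u) key
    · have hmem : ((τ v : V →L[ℝ] ℝ) : V →ₗ[ℝ] ℝ) ∈
          LinearMap.range (A : V →ₗ[ℝ] U).dualMap := by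
        rw [LinearMap.range_dualMap_eq_dualAnnihilator_ker, Submodule.mem_dualAnnihilator]
        exact hτ
      obtain ⟨l, hl⟩ := hmem
      have key := h (v, -LinearMap.toContinuousLinearMap l) (by
        refine Prod.ext (ContinuousLinearMap.ext fun w => ?_) (by simpa [augmentedSystem] using hv)
        have hw : l (A w) = τ v w := LinearMap.congr_fun hl w
        simp [augmentedSystem, hw])
      exact congrArg Prod.fst key
  · rintro ⟨hs, hn⟩ ⟨v, l⟩ h
    have hv : A v = 0 := congrArg Prod.snd h
    have hl (w : V) : τ v w + l (A w) = 0 :=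
      congrArg (fun p : (V →L[ℝ] ℝ) × U => p.1 w) h
    obtain rfl : v = 0 := hn v hv fun w hw => by simpa [hw] using hl w
    refine Prod.ext rfl (ContinuousLinearMap.ext fun u => ?_)
    obtain ⟨w, rfl⟩ := hs u
    simpa using hl w

theorem Continuous.clm_prod {X E F G : Type*} [TopologicalSpace X]
    [NormedAddCommGroup E] [NormedSpace ℝ E] [NormedAddCommGroup F] [NormedSpace ℝ F]
    [NormedAddCommGroup G] [NormedSpace ℝ G] {f : X → E →L[ℝ] F} {g : X → E →L[ℝ] G}
    (hf : Continuous f) (hg : Continuous g) : Continuous fun x => (f x).prod (g x) :=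
  (ContinuousLinearMap.prodₗᵢ (𝕜 := ℝ) (E := E) (F := F) (G := G) ℝ).continuous.comp
    (hf.prodMk hg)

theorem continuous_augmentedSystem {V U : Type*} [NormedAddCommGroup V] [NormedSpace ℝ V]
    [NormedAddCommGroup U] [NormedSpace ℝ U] (τ : V →L[ℝ] V →L[ℝ] ℝ) :
    Continuous (augmentedSystem (U := U) τ) := by
  refine Continuous.clm_prod (.add ?_ ?_) (continuous_id.clm_comp continuous_const)
  · exact continuous_const
  · exact (ContinuousLinearMap.continuous _).clm_comp continuous_const

/-- Surjectivity of `A` together with nondegeneracy of `τ` on `ker A` is an open condition on `A`. -/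
theorem isOpen_surjective_and_nondegenerate_on_ker {V U : Type*}
    [NormedAddCommGroup V] [NormedSpace ℝ V] [FiniteDimensional ℝ V]
    [NormedAddCommGroup U] [NormedSpace ℝ U] [FiniteDimensional ℝ U]
    (τ : V →L[ℝ] V →L[ℝ] ℝ) :
    IsOpen {A : V →L[ℝ] U | Function.Surjective A ∧
      ∀ v, A v = 0 → (∀ w, A w = 0 → τ v w = 0) → v = 0} := by
  have : FiniteDimensional ℝ (U →L[ℝ] ℝ) :=
    LinearMap.toContinuousLinearMap.finiteDimensional
  have hopen : IsOpen {T : V × (U →L[ℝ] ℝ) →L[ℝ] (V →L[ℝ] ℝ) × U | Function.Injective T} :=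
    ContinuousLinearMap.isOpen_injective
  simp only [← augmentedSystem_injective_iff]
  exact hopen.preimage (continuous_augmentedSystem τ)

/-- The pair of a linear map `T` and a linear functional `f` is surjective exactly when `T` is
surjective and `f` does not vanish on `ker T`. -/
theorem LinearMap.prod_surjective_iff_not_ker_le {K V U : Type*} [Field K] [AddCommGroup V]
    [Module K V] [AddCommGroup U] [Module K U] (T : V →ₗ[K] U) (f : V →ₗ[K] K) :
    Function.Surjective (T.prod f) ↔
      Function.Surjective T ∧ ¬ LinearMap.ker T ≤ LinearMap.ker f := by
  constructor
  · refine fun h => ⟨fun u => ?_, fun hle => ?_⟩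
    · obtain ⟨v, hv⟩ := h (u, 0)
      exact ⟨v, congrArg Prod.fst hv⟩
    · obtain ⟨v, hv⟩ := h (0, 1)
      have hT : T v = 0 := congrArg Prod.fst hv
      have hf : f v = 1 := congrArg Prod.snd hv
      exact zero_ne_one ((hle hT : f v = 0).symm.trans hf)
  · rintro ⟨hT, hle⟩ ⟨u, c⟩
    obtain ⟨k, hk, hfk⟩ := SetLike.not_le_iff_exists.mp hle
    rw [LinearMap.mem_ker] at hk hfk
    obtain ⟨v, rfl⟩ := hT u
    refine ⟨v + ((c - f v) / f k) • k, Prod.ext ?_ ?_⟩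
    · simp [hk]
    · simp [hfk]


/-- Let `V`, `W` be finite-dimensional real normed spaces, `θ` a nonzero
linear functional on `V`, `τ` an alternating bilinear form on `V` nondegenerate on `ker θ`,
and `Z ≤ W` with quotient map `π = Z.mkQ`.  The set of continuous linear maps `L : V → W`
such that `π ∘ L` is surjective, `K_L = ker (π ∘ L)` is not contained in `ker θ`, and `τ`
restricted to `K_L ∩ ker θ` is nondegenerate, is open in the operator-norm topology. -/
theorem almost_contact_transversal_relation_isOpen
    (V W : Type*) [NormedAddCommGroup V] [NormedSpace ℝ V] [FiniteDimensional ℝ V]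
    [NormedAddCommGroup W] [NormedSpace ℝ W] [FiniteDimensional ℝ W]
    (θ : V →ₗ[ℝ] ℝ) (hθ : θ ≠ 0)
    (τ : V →ₗ[ℝ] V →ₗ[ℝ] ℝ) (halt : ∀ v : V, τ v v = 0)
    (hnd : ∀ v ∈ LinearMap.ker θ, (∀ w ∈ LinearMap.ker θ, τ v w = 0) → v = 0)
    (Z : Submodule ℝ W) :
    IsOpen {L : V →L[ℝ] W |
      Function.Surjective (Z.mkQ ∘ₗ (L : V →ₗ[ℝ] W)) ∧
      ¬ (LinearMap.ker (Z.mkQ ∘ₗ (L : V →ₗ[ℝ] W)) ≤ LinearMap.ker θ) ∧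
      (∀ v ∈ LinearMap.ker (Z.mkQ ∘ₗ (L : V →ₗ[ℝ] W)) ⊓ LinearMap.ker θ,
        (∀ w ∈ LinearMap.ker (Z.mkQ ∘ₗ (L : V →ₗ[ℝ] W)) ⊓ LinearMap.ker θ, τ v w = 0) →
        v = 0)} := by
  have : IsClosed (Z : Set W) := Z.closed_of_finiteDimensional
  let q : W →L[ℝ] W ⧸ Z := LinearMap.toContinuousLinearMap Z.mkQ
  let θ' : V →L[ℝ] ℝ := LinearMap.toContinuousLinearMap θ
  let τ' : V →L[ℝ] V →L[ℝ] ℝ := LinearMap.toContinuousLinearMap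
    ((LinearMap.toContinuousLinearMap : (V →ₗ[ℝ] ℝ) ≃ₗ[ℝ] V →L[ℝ] ℝ).toLinearMap ∘ₗ τ)
  have hcont : Continuous fun L : V →L[ℝ] W => (q ∘L L).prod θ' :=
    (continuous_const.clm_comp continuous_id).clm_prod continuous_const
  convert (isOpen_surjective_and_nondegenerate_on_ker τ').preimage hcont using 1
  ext L
  rw [Set.mem_ofPred_eq, ← and_assoc, ← LinearMap.prod_surjective_iff_not_ker_le]
  refine and_congr Iff.rfl (forall_congr' fun v => ?_)
  have hmem (w : V) : w ∈ LinearMap.ker (Z.mkQ ∘ₗ (L : V →ₗ[ℝ] W)) ⊓ LinearMap.ker θ ↔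
      (q ∘L L).prod θ' w = 0 :=
    (Prod.ext_iff (x := (q ∘L L).prod θ' w) (y := 0)).symm
  simp only [hmem]
  rfl
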